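/- Lemma 3.1, upper bound (loop-measure crossing estimate): Assume 0 < ν ≤ α/2. There exists C such that for all ζ ≥ C, R ≥ 1, x ∈ G, and K ⊂ B(x,R): μ(γ : γ intersects both K and B(x, ζR)^c) ≤ C · cap(K) · (ζR)^{−ν}. -/

import Mathlib

open MeasureTheory ProbabilityTheory Real Filter Topology
open scoped ENNReal NNReal BigOperators Classical

noncomputable section

/-! ## Generic exponents and corrections -/

/-- The exponent `b₁`: equal to `1` if `ν = 1` and `0` otherwise. -/
def bOne (ν : ℝ) : ℝ := if ν = 1 then 1 else 0

/-- The exponent `b₂`: equal to `1` if `α = 2ν` and `0` otherwise. -/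
def bTwo (ν α : ℝ) : ℝ := if α = 2 * ν then 1 else 0

/-- The polylogarithmic correction `q(r)` from Theorem 1.1. -/
def qArm (ν α r : ℝ) : ℝ :=
  if ν = 1 then Real.log (Real.log r)
  else if ν < α / 2 then Real.log r ^ ((ν - 1) / 2) * Real.log (Real.log r) ^ ν
  else Real.log r ^ ν * Real.log (Real.log r) ^ ν

/-- `exp(-t)` for an extended nonnegative real `t`. -/
def expNegE (t : ℝ≥0∞) : ℝ≥0∞ := if t = ⊤ then 0 else ENNReal.ofReal (Real.exp (-t.toReal))

/-! ## Transient weighted graphs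

A weighted graph `𝒢 = (G, λ)`, connected and locally finite, with controlled weights,
equipped with a metric `d`, a distinguished base point `o`, and exponents `α` (volume
growth) and `ν` (Green's function decay). -/

structure WGraph where
  (V : Type) (countableV : Countable V) (o : V)
  (lam : V → V → ℝ)
  (lam_nonneg : ∀ x y, 0 ≤ lam x y)
  (lam_symm : ∀ x y, lam x y = lam y x)
  (locFin : ∀ x, (Function.support (lam x)).Finite)
  (connectedG : ∀ x y, Relation.ReflTransGen (fun u v => 0 < lam u v) x y)
  -- controlled weights: `λ_{x,y}/λ_x ≥ c₀` for all neighbours `x ∼ y`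
  (ctrl : ∃ c₀ > (0:ℝ), ∀ x y, 0 < lam x y → c₀ * (∑ᶠ z, lam x z) ≤ lam x y)
  (d : V → V → ℝ)
  (d_symm : ∀ x y, d x y = d y x)
  (d_self : ∀ x, d x x = 0)
  (d_pos : ∀ x y, x ≠ y → 0 < d x y)
  (d_triangle : ∀ x y z, d x z ≤ d x y + d y z)
  (α : ℝ) (ν : ℝ)

namespace WGraph

variable (M : WGraph)

/-- Total weight `λ_x = Σ_{y} λ_{x,y}` at a vertex. -/
def lamTot (x : M.V) : ℝ := ∑ᶠ y, M.lam x y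

/-- The (closed) ball `B(x,r)` for the metric `d`. -/
def ball (x : M.V) (r : ℝ) : Set M.V := {y | M.d x y ≤ r}

/-- One-step transition probability of the random walk on `(G,λ)`. -/
def p (x y : M.V) : ℝ := M.lam x y / M.lamTot x

/-- `n`-step transition probability of the random walk. -/
def pstep : ℕ → M.V → M.V → ℝ
  | 0, x, y => if x = y then 1 else 0
  | n + 1, x, y => ∑ᶠ z, M.p x z * pstep n z y

/-- The Green's function `g(x,y) = λ_y^{-1} Σ_{n ≥ 0} P_x[Z_n = y]` of the walk. -/
def green (x y : M.V) : ℝ := (∑' n, M.pstep n x y) / M.lamTot y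

/-- Transience of the random walk on `𝒢`. -/
def Transient : Prop := ∀ x, Summable fun n => M.pstep n x x

/-- The volume growth condition `(V_α)`. -/
def VolGrowth : Prop :=
  ∃ c > (0:ℝ), ∃ C > (0:ℝ), ∀ (x : M.V) (r : ℝ), 1 ≤ r →
    c * r ^ M.α ≤ (∑ᶠ y ∈ M.ball x r, M.lamTot y) ∧
      (∑ᶠ y ∈ M.ball x r, M.lamTot y) ≤ C * r ^ M.α

/-- The Green's function decay condition `(G_ν)`. -/
def GreenDecay : Prop :=
  ∃ c > (0:ℝ), ∃ C > (0:ℝ),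
    (∀ x : M.V, c ≤ M.green x x ∧ M.green x x ≤ C) ∧
    ∀ x y : M.V, x ≠ y →
      c * M.d x y ^ (-M.ν) ≤ M.green x y ∧ M.green x y ≤ C * M.d x y ^ (-M.ν)

/-- The standing assumptions on the graph: transience, `(V_α)` and `(G_ν)`. -/
def Standing : Prop := M.Transient ∧ M.VolGrowth ∧ M.GreenDecay

/-- The graph distance `d_gr` on `𝒢`. -/
def graphDist (x y : M.V) : ℝ :=
  sInf {r : ℝ | ∃ n : ℕ, r = n ∧ ∃ γ : Fin (n + 1) → M.V, γ 0 = x ∧ γ (Fin.last n) = y ∧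
    ∀ i : Fin n, 0 < M.lam (γ i.castSucc) (γ i.succ)}

/-- Capacity of a finite set of vertices, via the variational characterization
`cap(K) = (inf_μ Σ_{x,y} μ(x) g(x,y) μ(y))⁻¹`, the infimum being over probability
measures supported on `K`. -/
def capFinset (K : Finset M.V) : ℝ :=
  (sInf {E : ℝ | ∃ μ : M.V → ℝ, (∀ x, 0 ≤ μ x) ∧ (∀ x, x ∉ K → μ x = 0) ∧
    (∑ x ∈ K, μ x) = 1 ∧ E = ∑ x ∈ K, ∑ y ∈ K, μ x * M.green x y * μ y})⁻¹

/-- Capacity of an arbitrary set of vertices. -/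
def cap (S : Set M.V) : ℝ := ⨆ K : {K : Finset M.V // ↑K ⊆ S}, M.capFinset K.1

/-- Weight `∏_{i<n} p(x_i, x_{i+1})` of a finite random walk trajectory. -/
def pathWt {n : ℕ} (γ : Fin (n + 1) → M.V) : ℝ := ∏ i : Fin n, M.p (γ i.castSucc) (γ i.succ)

/-- `P_z[H_x < H_O]`: the probability that the random walk started at `z` hits `x`
strictly before hitting the set `O`, expressed through a first-passage path decomposition. -/
def hitBefore (z x : M.V) (O : Set M.V) : ℝ :=
  ∑' n : ℕ, ∑' γ : Fin (n + 1) → M.V,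
    if γ 0 = z ∧ γ (Fin.last n) = x ∧ x ∉ O ∧
        (∀ i : Fin (n + 1), i ≠ Fin.last n → γ i ∉ O ∧ γ i ≠ x)
      then M.pathWt γ else 0

/-- Distance from a point to a set. -/
def dSet (x : M.V) (S : Set M.V) : ℝ := sInf (M.d x '' S)

/-! ### Discrete (rooted) loops

A rooted discrete loop visiting `m + 2` vertices (`m ≥ 0`), i.e. making at least two
jumps, encoded by its skeleton `Z_0, …, Z_{n-1}` (with `Z_n = Z_0`, indices mod `n`). -/

/-- The type of rooted discrete loops on `G` making `n = m + 2 ≥ 2` jumps. -/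
abbrev DLoop : Type := Σ m : ℕ, Fin (m + 2) → M.V

/-- The mass `(1/n) ∏_{0 ≤ i < n} λ_{x_i,x_{i+1}}/λ_{x_i}` that the loop measure `μ`
assigns to a given rooted discrete loop (its discrete skeleton intensity). -/
def dloopWt (γ : M.DLoop) : ℝ≥0∞ :=
  ENNReal.ofReal ((1 / ((γ.1 : ℝ) + 2)) * ∏ i : Fin (γ.1 + 2), M.p (γ.2 i) (γ.2 (i + 1)))

/-- The set of vertices visited by a discrete loop (`range(γ) ∩ G` for the
corresponding continuous loop). -/
def dloopRange (γ : M.DLoop) : Set M.V := Set.range γ.2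

/-- The loop measure `μ` evaluated on a set of (skeletons of) loops: since the events of
interest only depend on the vertices visited by a loop, the measure under `μ` of such an
event coincides with the total mass of the corresponding discrete skeletons. -/
def loopMeas (S : Set M.DLoop) : ℝ≥0∞ := ∑' γ : S, M.dloopWt γ

end WGraph

/-! ## Graphs equipped with an approximate renormalized lattice `Λ(L)` -/

structure LGraph extends WGraph where
  (Lat : ℝ → Set V)
  (Lat_base : ∀ L : ℝ, 1 ≤ L → o ∈ Lat L)
  (Lat_cover : ∀ L : ℝ, 1 ≤ L → ∀ x, ∃ y ∈ Lat L, d y x ≤ L)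
  (Lat_disj : ∀ L : ℝ, 1 ≤ L → ∀ y ∈ Lat L, ∀ z ∈ Lat L, y ≠ z →
    ∀ w, d y w ≤ L / 2 → ¬ d z w ≤ L / 2)
  (Lat_card : ∃ CΛ > (0:ℝ), ∀ L : ℝ, 1 ≤ L → ∀ (x : V) (N : ℕ), 1 ≤ N →
    {y | y ∈ Lat L ∧ d x y ≤ L * N}.Finite ∧
      ({y | y ∈ Lat L ∧ d x y ≤ L * N}.ncard : ℝ) ≤ CΛ * (N : ℝ) ^ α)

namespace LGraph

variable (M : LGraph)

/-- A path `π = (x_i)_{1 ≤ i ≤ M}` in `Λ(L)` from the base point `0` to `A ⊆ G`. -/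
def IsLatPath (L : ℝ) (A : Set M.V) {m : ℕ} (pa : Fin (m + 1) → M.V) : Prop :=
  pa 0 = M.o ∧ pa (Fin.last m) ∈ A ∧ (∀ i, pa i ∈ M.Lat L) ∧
    ∀ i : Fin m, ∃ x y, M.d (pa i.castSucc) x ≤ L ∧ M.d (pa i.succ) y ≤ L ∧ 0 < M.lam x y

/-- `𝒪 ⊆ G` is an `(L,R,n,κ)`-good obstacle: every path in `Λ(L)` from `0` to `B_R^c`
contains at least `n` points `y` (within `B_R`) with `cap(𝒪 ∩ B(y,L)) ≥ κ`. -/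
def GoodObstacle (O : Set M.V) (L R : ℝ) (n : ℝ) (κ : ℝ) : Prop :=
  ∀ (m : ℕ) (pa : Fin (m + 1) → M.V), M.IsLatPath L {y | R < M.d M.o y} pa →
    ∃ A : Finset M.V, (∀ y ∈ A, (∃ i, pa i = y) ∧ M.d M.o y ≤ R) ∧ n ≤ (A.card : ℝ) ∧
      ∀ y ∈ A, κ ≤ M.toWGraph.cap (O ∩ {z | M.d y z ≤ L})

/-- The layer `𝒜_k ⊆ Λ(L)` of lattice points whose `L`-ball meets the interior
boundary `∂B(0, C₁ k L)`. -/
def layer (C₁ L : ℝ) (k : ℕ) : Set M.V :=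
  {x | x ∈ M.Lat L ∧ ∃ y, M.d x y ≤ L ∧ M.d M.o y ≤ C₁ * k * L ∧
    ∃ z, 0 < M.lam y z ∧ C₁ * k * L < M.d M.o z}

/-- The annulus `𝔸_k = ∪_{x ∈ 𝒜_k} B(x,L)`. -/
def annulus (C₁ L : ℝ) (k : ℕ) : Set M.V := {v | ∃ x ∈ M.layer C₁ L k, M.d x v ≤ L}

end LGraph

/-! ## The Gaussian free field and its associated bond percolation `E^{≥a}` -/

/-- A transient weighted graph together with a Gaussian free field `φ` (law `ℙ`) and,
conditionally on `φ`, independent bond percolation configurations: each edge `{x,y}` is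
retained in `E^{≥a}` (i.e. `opn a`) independently with probability
`1 - exp(-2 λ_{x,y} (φ_x - a)_+ (φ_y - a)_+)`. -/
structure Model extends WGraph where
  (Ω : Type) [mΩ : MeasurableSpace Ω] (P : Measure Ω) (Pprob : IsProbabilityMeasure P)
  (φ : Ω → V → ℝ)
  (φ_meas : ∀ x, Measurable fun ω => φ ω x)
  -- `φ` is the centered Gaussian field with covariance the Green's function `g`
  (φ_gauss : ∀ (s : Finset V) (c : V → ℝ),
    Measure.map (fun ω => ∑ x ∈ s, c x * φ ω x) P =
      gaussianReal 0 (Real.toNNReal (∑ x ∈ s, ∑ y ∈ s, c x * c y * toWGraph.green x y)))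
  (opn : ℝ → Ω → V → V → Prop)
  (opn_symm : ∀ a ω x y, opn a ω x y → opn a ω y x)
  (opn_edge : ∀ a ω x y, opn a ω x y → 0 < lam x y)
  (opn_meas : ∀ a x y, MeasurableSet {ω | opn a ω x y})
  -- conditionally on `φ`, edges are open independently with the prescribed probabilities
  (opn_law : ∀ (a : ℝ) (s t : Finset (V × V)), Disjoint s t →
    (∀ e ∈ s ∪ t, ∀ f ∈ s ∪ t, e ≠ f → e ≠ Prod.swap f) →
    ∀ B : Set (V → ℝ), MeasurableSet B →
      P ({ω | φ ω ∈ B} ∩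
          {ω | (∀ e ∈ s, opn a ω e.1 e.2) ∧ (∀ e ∈ t, ¬ opn a ω e.1 e.2)}) =
      ∫⁻ ω in {ω | φ ω ∈ B},
        ENNReal.ofReal
          ((∏ e ∈ s,
            (1 - Real.exp (-(2 * lam e.1 e.2 * max (φ ω e.1 - a) 0 * max (φ ω e.2 - a) 0)))) *
           ∏ e ∈ t,
            Real.exp (-(2 * lam e.1 e.2 * max (φ ω e.1 - a) 0 * max (φ ω e.2 - a) 0))) ∂P)

attribute [instance] Model.mΩ

namespace Model

variable (M : Model)

/-- `x` and `y` are connected by a path of open edges of `E^{≥a}`. -/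
def conn (a : ℝ) (ω : M.Ω) (x y : M.V) : Prop :=
  Relation.ReflTransGen (fun u v => M.opn a ω u v) x y

/-- The open cluster `𝒦^a` of `x` in `E^{≥a}`. -/
def cluster (a : ℝ) (ω : M.Ω) (x : M.V) : Set M.V := {y | M.conn a ω x y}

/-- The probability of an event. -/
def prob (s : Set M.Ω) : ℝ := (M.P s).toReal

/-- The one-arm event `{x ↔ B(x,R)^c}` in `E^{≥0}`. -/
def armEvent (x : M.V) (R : ℝ) : Set M.Ω := {ω | ∃ y, R < M.d x y ∧ M.conn 0 ω x y}

/-- The truncated two-point function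
`τ_a^tr(x,y) = ℙ(x ↔ y in E^{≥a}, x ↮ ∞ in E^{≥a})`. -/
def tau (a : ℝ) (x y : M.V) : ℝ :=
  M.prob {ω | M.conn a ω x y ∧ (M.cluster a ω x).Finite}

/-- The truncated expected cluster volume `𝔼[|𝒦^a| 1_{|𝒦^a| < ∞}]`. -/
def clusterVol (a : ℝ) (x : M.V) : ℝ≥0∞ :=
  ∫⁻ ω, (if (M.cluster a ω x).Finite then ((M.cluster a ω x).ncard : ℝ≥0∞) else 0) ∂M.P

end Model

/-! ## The concrete case `G = ℤ³` with unit weights and the Euclidean distance -/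

/-- The vertex set `ℤ³`. -/
abbrev Z3 : Type := Fin 3 → ℤ

/-- Euclidean distance on `ℤ³`. -/
def dZ (x y : Z3) : ℝ := Real.sqrt (∑ i, ((x i : ℝ) - (y i : ℝ)) ^ 2)

/-- Unit weights: `λ_{x,y} = 1_{|x-y| = 1}`. -/
def lamZ (x y : Z3) : ℝ := if dZ x y = 1 then 1 else 0

/-- Transition probabilities of simple random walk on `ℤ³`. -/
def pZ (x y : Z3) : ℝ := lamZ x y / 6

/-- `n`-step transition probabilities of simple random walk on `ℤ³`. -/
def pstepZ : ℕ → Z3 → Z3 → ℝ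
  | 0, x, y => if x = y then 1 else 0
  | n + 1, x, y => ∑ᶠ z, pZ x z * pstepZ n z y

/-- The Green's function of simple random walk on `ℤ³` (with the normalization
`g(x,y) = λ_y^{-1} Σ_n P_x[Z_n = y]`, `λ_y = 6`). -/
def greenZ (x y : Z3) : ℝ := (∑' n, pstepZ n x y) / 6

/-- Euclidean distance between a point of `ℝ³` and a point of `ℤ³`. -/
def dMix (u : Fin 3 → ℝ) (z : Z3) : ℝ := Real.sqrt (∑ i, (u i - (z i : ℝ)) ^ 2)

/-- The Gaussian free field on `ℤ³` together with the associated bond percolation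
configurations `E^{≥a}`. -/
structure PercZ3 where
  (Ω : Type) [mΩ : MeasurableSpace Ω] (P : Measure Ω) (Pprob : IsProbabilityMeasure P)
  (φ : Ω → Z3 → ℝ)
  (φ_meas : ∀ x, Measurable fun ω => φ ω x)
  (φ_gauss : ∀ (s : Finset Z3) (c : Z3 → ℝ),
    Measure.map (fun ω => ∑ x ∈ s, c x * φ ω x) P =
      gaussianReal 0 (Real.toNNReal (∑ x ∈ s, ∑ y ∈ s, c x * c y * greenZ x y)))
  (opn : ℝ → Ω → Z3 → Z3 → Prop)
  (opn_symm : ∀ a ω x y, opn a ω x y → opn a ω y x)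
  (opn_edge : ∀ a ω x y, opn a ω x y → 0 < lamZ x y)
  (opn_meas : ∀ a x y, MeasurableSet {ω | opn a ω x y})
  (opn_law : ∀ (a : ℝ) (s t : Finset (Z3 × Z3)), Disjoint s t →
    (∀ e ∈ s ∪ t, ∀ f ∈ s ∪ t, e ≠ f → e ≠ Prod.swap f) →
    ∀ B : Set (Z3 → ℝ), MeasurableSet B →
      P ({ω | φ ω ∈ B} ∩
          {ω | (∀ e ∈ s, opn a ω e.1 e.2) ∧ (∀ e ∈ t, ¬ opn a ω e.1 e.2)}) =
      ∫⁻ ω in {ω | φ ω ∈ B},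
        ENNReal.ofReal
          ((∏ e ∈ s,
            (1 - Real.exp (-(2 * lamZ e.1 e.2 * max (φ ω e.1 - a) 0 * max (φ ω e.2 - a) 0)))) *
           ∏ e ∈ t,
            Real.exp (-(2 * lamZ e.1 e.2 * max (φ ω e.1 - a) 0 * max (φ ω e.2 - a) 0))) ∂P)

attribute [instance] PercZ3.mΩ

namespace PercZ3

variable (M : PercZ3)

/-- Connectivity by open edges in `E^{≥a}`. -/
def conn (a : ℝ) (ω : M.Ω) (x y : Z3) : Prop :=
  Relation.ReflTransGen (fun u v => M.opn a ω u v) x y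

/-- The open cluster of `x` in `E^{≥a}`. -/
def cluster (a : ℝ) (ω : M.Ω) (x : Z3) : Set Z3 := {y | M.conn a ω x y}

/-- The truncated two-point function on `ℤ³`. -/
def tau (a : ℝ) (x y : Z3) : ℝ :=
  ((M.P {ω | M.conn a ω x y ∧ (M.cluster a ω x).Finite}).toReal)

end PercZ3

/-! ## The metric graph (cable system) `𝔾̃`, killed Green's functions and killed GFFs -/

/-- The cable system `𝔾̃` over a graph `𝒢` (with renormalized lattice), together with the
killed Green's functions `g_U` and the laws `ℙ_U` of the Gaussian free field on open sets
`U ⊆ 𝔾̃` (the field killed outside `U`). -/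
structure CableG extends LGraph where
  (Gt : Type) [topGt : TopologicalSpace Gt] [msGt : MeasurableSpace Gt]
  (ι : V → Gt) (ι_inj : Function.Injective ι)
  (gU : Set Gt → Gt → Gt → ℝ)
  (gU_symm : ∀ U x y, gU U x y = gU U y x)
  (gU_zero : ∀ U x y, x ∉ U → gU U x y = 0)
  -- the Green's function of the full cable system restricts to `g` on `G`
  (gU_univ : ∀ x y : V, gU Set.univ (ι x) (ι y) = toWGraph.green x y)
  (PU : Set Gt → Measure (Gt → ℝ))
  (PU_prob : ∀ U, IsProbabilityMeasure (PU U))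
  -- `ℙ_U` is the law of the centered Gaussian field with covariance `g_U`
  (PU_gauss : ∀ (U : Set Gt) (s : Finset Gt) (c : Gt → ℝ),
    Measure.map (fun h => ∑ q ∈ s, c q * h q) (PU U) =
      gaussianReal 0 (Real.toNNReal (∑ q ∈ s, ∑ q' ∈ s, c q * c q' * gU U q q')))

attribute [instance] CableG.topGt CableG.msGt

/-- A probability space. -/
structure ProbSpace where
  (Ω : Type) [mΩ : MeasurableSpace Ω] (P : Measure Ω) (Pprob : IsProbabilityMeasure P)

attribute [instance] ProbSpace.mΩ

/-- A cable system as above, together with the laws of the vacant sets `Ṽ^u` of random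
interlacements at level `u > 0` on `𝔾̃`, axiomatized through their characterizing
properties: `Ṽ^u` is open and `ℙ(F ⊆ Ṽ^u) = exp(-u cap(F))` for finite `F ⊆ G`. -/
structure CableRI extends CableG where
  [msSetGt : MeasurableSpace (Set Gt)]
  (RIVacant : ℝ → Measure (Set Gt))
  (RIVacant_prob : ∀ u : ℝ, 0 < u → IsProbabilityMeasure (RIVacant u))
  (RIVacant_open : ∀ u : ℝ, 0 < u → ∀ᵐ S ∂(RIVacant u), @IsOpen Gt topGt S)
  (RIVacant_cap : ∀ u : ℝ, 0 < u → ∀ F : Finset V,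
    (RIVacant u {S | ∀ x ∈ F, ι x ∈ S}).toReal =
      Real.exp (-(u * toWGraph.capFinset F)))

attribute [instance] CableRI.msSetGt

/-! ## The Markovian loop soup at intensity `1/2` on the cable system -/

/-- The Poisson loop soup `ℒ` of intensity `(1/2)μ` on the cable system `𝔾̃` of a graph
`𝒢` (with renormalized lattice), under the law `Q`.  Continuous loops are axiomatized
through their ranges in `𝔾̃` and their discrete skeletons; the intensity measure `μ` is
pinned down via its (concrete) discrete skeleton intensity, and the law of the soup via
its void probabilities `Q(ℒ ∩ S = ∅) = exp(-μ(S)/2)`. -/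
structure LoopSoup extends LGraph where
  -- the cable system
  (Gt : Type) [topGt : TopologicalSpace Gt]
  (ι : V → Gt) (ι_inj : Function.Injective ι)
  (cable : V → V → Set Gt)
  (cable_symm : ∀ x y, cable x y = cable y x)
  (cable_ends : ∀ x y, 0 < lam x y → ι x ∈ cable x y ∧ ι y ∈ cable x y)
  (cable_vertices : ∀ x y, 0 < lam x y → ∀ v : V, ι v ∈ cable x y → v = x ∨ v = y)
  (cable_cover : ∀ q : Gt, (∃ v, q = ι v) ∨ ∃ x y, 0 < lam x y ∧ q ∈ cable x y)
  -- continuous loops on the cable system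
  (CLoop : Type) [msLoop : MeasurableSpace CLoop]
  (crange : CLoop → Set Gt)
  (traceG : CLoop → Set V)
  (trace_spec : ∀ γ, traceG γ = {v | ι v ∈ crange γ})
  -- the loop measure `μ` and its discrete skeleton
  (μC : Measure CLoop)
  (skel : CLoop → Option (Σ m : ℕ, Fin (m + 2) → V))
  (skel_spec : ∀ γ dγ, skel γ = some dγ → traceG γ = Set.range dγ.2)
  (skel_trivial : ∀ γ, skel γ = none → (traceG γ).Subsingleton)
  (μC_skel : ∀ S : Set (Σ m : ℕ, Fin (m + 2) → V),
    μC {γ | ∃ dγ ∈ S, skel γ = some dγ} = toWGraph.loopMeas S)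
  -- the loop soup and its law
  (Ωq : Type) [mΩq : MeasurableSpace Ωq] (Q : Measure Ωq) (Qprob : IsProbabilityMeasure Q)
  (soup : Ωq → Set CLoop)
  (soup_void : ∀ S : Set CLoop, MeasurableSet S →
    Q {ω | ∀ γ ∈ soup ω, γ ∉ S} = expNegE (μC S / 2))

attribute [instance] LoopSoup.topGt LoopSoup.msLoop LoopSoup.mΩq

namespace LoopSoup

variable (M : LoopSoup)

/-- Two loops of the soup are linked if they can be joined by a finite chain of loops of
the soup whose ranges successively intersect. -/
def linked (ω : M.Ωq) (γ γ' : M.CLoop) : Prop :=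
  Relation.ReflTransGen
    (fun g g' => g ∈ M.soup ω ∧ g' ∈ M.soup ω ∧ (M.crange g ∩ M.crange g').Nonempty) γ γ'

/-- The trace `𝒞` on `𝔾̃` of the cluster of loops of `ℒ` containing the base point `0`. -/
def C0 (ω : M.Ωq) : Set M.Gt :=
  {q | ∃ γ ∈ M.soup ω, q ∈ M.crange γ ∧
    ∃ γ₀ ∈ M.soup ω, M.ι M.o ∈ M.crange γ₀ ∧ M.linked ω γ γ₀}

/-- A loop is big (for the parameters `δ, L`) if `cap(range(γ) ∩ G) ≥ δ L^ν (log L)^{-b₂}`. -/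
def isBig (δ L : ℝ) (γ : M.CLoop) : Prop :=
  δ * L ^ M.ν * Real.log L ^ (-(bTwo M.ν M.α)) ≤ M.toWGraph.cap (M.traceG γ)

/-- The box `B̃(x,L) ⊆ 𝔾̃`: the ball `B(x,L)` together with all cables joining
neighbouring vertices of `B(x,L)`. -/
def Btilde (x : M.V) (L : ℝ) : Set M.Gt :=
  (M.ι '' {y | M.d x y ≤ L}) ∪
    ⋃ (u : M.V) (v : M.V) (_ : 0 < M.lam u v ∧ M.d x u ≤ L ∧ M.d x v ≤ L), M.cable u v

/-- A loop belongs to (the support of) `ℒ_k^b`: it is big and its range is contained in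
`B̃(x,L)` for some `x ∈ 𝒜_k`. -/
def inLayerBig (C₁ δ L : ℝ) (k : ℕ) (γ : M.CLoop) : Prop :=
  M.isBig δ L γ ∧ ∃ x ∈ M.toLGraph.layer C₁ L k, M.crange γ ⊆ M.Btilde x L

/-- The event `𝐁_k`: the cluster `𝒞` of `0` reaches `B_R^c` but contains no big loop of
`ℒ_k^b`. -/
def Bk (C₁ δ L R : ℝ) (k : ℕ) : Set M.Ωq :=
  {ω | (∃ y : M.V, R < M.d M.o y ∧ M.ι y ∈ M.C0 ω) ∧
    ∀ γ ∈ M.soup ω, M.inLayerBig C₁ δ L k γ → ¬ M.crange γ ⊆ M.C0 ω}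

/-- The number `N` of bad annuli among `k ∈ {1, …, ℓ}`. -/
def Nbad (C₁ δ L R : ℝ) (ℓ : ℕ) (ω : M.Ωq) : ℕ :=
  ((Finset.Icc 1 ℓ).filter fun k => ω ∈ M.Bk C₁ δ L R k).card

/-- The obstacle set `𝒪 = G ∩ 𝐼̃_D^b`: all vertices visited by a big loop of the soup
contained in a box `B̃(x,L)` with `x ∈ 𝒜_k` for some `k ∈ D`. -/
def obstacleD (C₁ δ L : ℝ) (D : Finset ℕ) (ω : M.Ωq) : Set M.V :=
  {v | ∃ γ ∈ M.soup ω, (∃ k ∈ D, M.inLayerBig C₁ δ L k γ) ∧ M.ι v ∈ M.crange γ}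

end LoopSoup

/-! ## Nonnegative kernels, path sums and escape functions -/

namespace PathKernel

variable {V : Type} (k : V → V → ℝ≥0∞)

/-- The action of a kernel on a nonnegative function. -/
def avg (f : V → ℝ≥0∞) (a : V) : ℝ≥0∞ := ∑' z, k a z * f z

/-- The powers of a kernel. -/
def iter : ℕ → V → V → ℝ≥0∞
  | 0, a, b => if a = b then 1 else 0
  | n + 1, a, b => ∑' z, k a z * iter n z b

/-- The potential kernel `Σ_n kⁿ`. -/
def potential (a b : V) : ℝ≥0∞ := ∑' n, iter k n a b

/-- The weight of the path `a → δ 0 → ⋯ → δ (n - 1) → b`. -/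
def bridgeWt : (n : ℕ) → V → V → (Fin n → V) → ℝ≥0∞
  | 0, a, b, _ => k a b
  | n + 1, a, b, δ => k a (δ 0) * bridgeWt n (δ 0) b (Fin.tail δ)

/-- The path `δ` visits `O` no later than its first visit to `K`. -/
def Reaches (K O : Set V) : (n : ℕ) → (Fin n → V) → Prop
  | 0, _ => False
  | n + 1, δ => δ 0 ∈ O ∨ δ 0 ∉ K ∧ Reaches K O n (Fin.tail δ)

/-- The total weight of the bridges from `a` to `b` with `n` intermediate points which reach
`O` before `K`. -/
def crossWt (K O : Set V) (n : ℕ) (a b : V) : ℝ≥0∞ :=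
  ∑' δ : Fin n → V, if Reaches K O n δ then bridgeWt k n a b δ else 0

/-- Iterates of averaging with zero boundary values on `K`. -/
def escape (K : Set V) (f : V → ℝ≥0∞) : ℕ → V → ℝ≥0∞
  | 0 => f
  | n + 1 => Kᶜ.indicator (avg k (escape K f n))

lemma avg_mono {f f' : V → ℝ≥0∞} (h : f ≤ f') : avg k f ≤ avg k f' := fun a =>
  ENNReal.tsum_le_tsum fun z => by gcongr; exact h z

lemma avg_add (f f' : V → ℝ≥0∞) (a : V) :
    avg k (fun z => f z + f' z) a = avg k f a + avg k f' a := by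
  simp only [avg, mul_add, ENNReal.tsum_add]

lemma avg_const_mul (c : ℝ≥0∞) (f : V → ℝ≥0∞) (a : V) :
    avg k (fun z => c * f z) a = c * avg k f a := by
  simp only [avg, ← ENNReal.tsum_mul_left]
  exact tsum_congr fun z => by ring

lemma avg_sum (N : ℕ) (f : ℕ → V → ℝ≥0∞) (a : V) :
    avg k (fun z => ∑ n ∈ Finset.range N, f n z) a = ∑ n ∈ Finset.range N, avg k (f n) a := by
  simp only [avg, Finset.mul_sum]
  exact Summable.tsum_finsetSum fun _ _ => ENNReal.summable

lemma avg_le_one (hk : ∀ a, ∑' z, k a z = 1) {f : V → ℝ≥0∞} (hf : ∀ z, f z ≤ 1) (a : V) :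
    avg k f a ≤ 1 := by
  rw [← hk a]
  exact ENNReal.tsum_le_tsum fun z => mul_le_of_le_one_right' (hf z)

lemma avg_iter (n : ℕ) (u : V → ℝ≥0∞) (a : V) :
    avg k (fun z => ∑' y, iter k n z y * u y) a = ∑' y, iter k (n + 1) a y * u y := by
  simp only [avg, iter, ← ENNReal.tsum_mul_left, ← ENNReal.tsum_mul_right]
  rw [ENNReal.tsum_comm]
  exact tsum_congr fun _ => tsum_congr fun _ => by ring

lemma tsum_iter_zero_mul (u : V → ℝ≥0∞) (a : V) : ∑' y, iter k 0 a y * u y = u a := by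
  rw [tsum_eq_single a fun y hy => by simp [iter, hy.symm]]
  simp [iter]

lemma iter_succ_le_potential (N : ℕ) (a b : V) :
    ∑ n ∈ Finset.range N, iter k (n + 1) a b ≤ potential k a b := by
  refine (ENNReal.sum_le_tsum _).trans ?_
  exact ENNReal.tsum_comp_le_tsum_of_injective (add_left_injective 1) fun n => iter k n a b

lemma avg_potential_le (b a : V) : avg k (fun z => potential k z b) a ≤ potential k a b := by
  have : avg k (fun z => potential k z b) a = ∑' n, iter k (n + 1) a b := by
    simp only [avg, potential, iter, ← ENNReal.tsum_mul_left]
    exact ENNReal.tsum_comm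
  rw [this]
  exact ENNReal.tsum_comp_le_tsum_of_injective (add_left_injective 1) fun n => iter k n a b

lemma tsum_fin_succ (n : ℕ) (F : (Fin (n + 1) → V) → ℝ≥0∞) :
    ∑' δ, F δ = ∑' z, ∑' δ : Fin n → V, F (Fin.cons z δ) := by
  rw [← ENNReal.tsum_prod, ← (Fin.consEquiv fun _ : Fin (n + 1) => V).tsum_eq F]
  rfl

lemma tsum_bridgeWt (n : ℕ) (a b : V) : ∑' δ, bridgeWt k n a b δ = iter k (n + 1) a b := by
  induction n generalizing a with
  | zero =>
    rw [iter, tsum_eq_single b fun z hz => by simp [iter, hz]]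
    simp [iter, bridgeWt]
  | succ n ih =>
    rw [tsum_fin_succ, iter]
    simp only [bridgeWt, Fin.cons_zero, Fin.tail_cons, ENNReal.tsum_mul_left, ih]

lemma crossWt_zero (K O : Set V) (a b : V) : crossWt k K O 0 a b = 0 := by
  simp [crossWt, Reaches]

lemma crossWt_succ_le (K O : Set V) (n : ℕ) (a b : V) :
    crossWt k K O (n + 1) a b ≤
      avg k (fun z => if z ∈ O then iter k (n + 1) z b
        else Kᶜ.indicator (fun z => crossWt k K O n z b) z) a := by
  rw [crossWt, tsum_fin_succ, avg]
  refine ENNReal.tsum_le_tsum fun z => ?_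
  simp only [Reaches, bridgeWt, Fin.cons_zero, Fin.tail_cons]
  by_cases hO : z ∈ O
  · simp [hO, ENNReal.tsum_mul_left, tsum_bridgeWt]
  · by_cases hK : z ∈ K
    · simp [hO, hK]
    · simp [hO, hK, crossWt, ← ENNReal.tsum_mul_left]

lemma reaches_of_exists {K O : Set V} {n : ℕ} {δ : Fin n → V} {j : Fin n} (hj : δ j ∈ O)
    (hlt : ∀ i < j, δ i ∉ K) : Reaches K O n δ := by
  induction n with
  | zero => exact j.elim0
  | succ n ih =>
    rw [Reaches]
    rcases Fin.eq_zero_or_eq_succ j with rfl | ⟨j, rfl⟩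
    · exact Or.inl hj
    · exact Or.inr ⟨hlt 0 (Fin.succ_pos j),
        ih (j := j) hj fun i hi => hlt i.succ (Fin.succ_lt_succ_iff.2 hi)⟩

section Escape

variable {k} {K O : Set V} {f : V → ℝ≥0∞}

lemma escape_eq_zero (hfK : ∀ y ∈ K, f y = 0) (n : ℕ) {y : V} (hy : y ∈ K) :
    escape k K f n y = 0 := by
  cases n with
  | zero => exact hfK y hy
  | succ n => simp [escape, hy]

lemma escape_le_succ (hfK : ∀ y ∈ K, f y = 0) (hf : f ≤ avg k f) (n : ℕ) :
    escape k K f n ≤ escape k K f (n + 1) := by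
  induction n with
  | zero =>
    intro y
    by_cases hy : y ∈ K
    · simp [escape, hfK y hy]
    · simpa [escape, hy] using hf y
  | succ n ih =>
    exact Set.indicator_mono (s := Kᶜ) (avg_mono k ih)

lemma le_escape (hfK : ∀ y ∈ K, f y = 0) (hf : f ≤ avg k f) (n : ℕ) :
    f ≤ escape k K f n := by
  induction n with
  | zero => exact le_rfl
  | succ n ih => exact ih.trans (escape_le_succ hfK hf n)

lemma escape_le_one (hk : ∀ a, ∑' z, k a z = 1) (hf1 : ∀ y, f y ≤ 1) (n : ℕ) (y : V) :
    escape k K f n y ≤ 1 := by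
  induction n generalizing y with
  | zero => exact hf1 y
  | succ n ih =>
    by_cases hy : y ∈ K
    · simp [escape, hy]
    · simpa [escape, hy] using avg_le_one k hk ih y

lemma escape_add_le (hfK : ∀ y ∈ K, f y = 0) (hf : f ≤ avg k f) (n : ℕ) (y : V) :
    K.indicator (avg k (escape k K f n)) y + escape k K f n y ≤ avg k (escape k K f n) y := by
  by_cases hy : y ∈ K
  · simp [hy, escape_eq_zero hfK n hy]
  · simpa [hy, escape] using escape_le_succ hfK hf n y

lemma sum_iter_add_le_one (hk : ∀ a, ∑' z, k a z = 1) {u h : V → ℝ≥0∞} (hh : ∀ y, h y ≤ 1)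
    (huh : ∀ y, u y + h y ≤ avg k h y) (N : ℕ) (y : V) :
    ∑ n ∈ Finset.range N, ∑' z, iter k n y z * u z + h y ≤ 1 := by
  induction N generalizing y with
  | zero => simpa using hh y
  | succ N ih =>
    calc ∑ n ∈ Finset.range (N + 1), ∑' z, iter k n y z * u z + h y
        = avg k (fun y => ∑ n ∈ Finset.range N, ∑' z, iter k n y z * u z) y + (u y + h y) := by
          rw [Finset.sum_range_succ', tsum_iter_zero_mul, avg_sum, add_assoc]
          simp only [avg_iter]
      _ ≤ avg k (fun y => ∑ n ∈ Finset.range N, ∑' z, iter k n y z * u z) y + avg k h y := by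
          gcongr
          exact huh y
      _ = avg k (fun y => ∑ n ∈ Finset.range N, ∑' z, iter k n y z * u z + h y) y :=
          (avg_add k _ _ y).symm
      _ ≤ 1 := avg_le_one k hk ih y

lemma sum_potential_mul_le_one (hk : ∀ a, ∑' z, k a z = 1) {u h : V → ℝ≥0∞}
    (hh : ∀ y, h y ≤ 1) (huh : ∀ y, u y + h y ≤ avg k h y) (y : V) :
    ∑' z, potential k y z * u z ≤ 1 := by
  have : ∑' z, potential k y z * u z = ∑' n, ∑' z, iter k n y z * u z := by
    simp only [potential, ← ENNReal.tsum_mul_right]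
    exact ENNReal.tsum_comm
  rw [this]
  exact ENNReal.tsum_le_of_sum_range_le fun N =>
    le_self_add.trans (sum_iter_add_le_one hk hh huh N y)

lemma sum_crossWt_le (hfK : ∀ y ∈ K, f y = 0) (hf : f ≤ avg k f) (hfO : ∀ y ∈ O, 1 ≤ 2 * f y)
    {b : V} {c : ℝ≥0∞} (hc : ∀ z ∈ O, potential k z b ≤ c) (N : ℕ) (a : V) :
    ∑ n ∈ Finset.range N, crossWt k K O n a b ≤ 2 * c * avg k (escape k K f N) a := by
  induction N generalizing a with
  | zero => simp
  | succ N ih =>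
    rw [Finset.sum_range_succ', crossWt_zero, add_zero]
    refine (Finset.sum_le_sum fun n _ => crossWt_succ_le k K O n a b).trans ?_
    rw [← avg_sum, ← avg_const_mul]
    refine avg_mono k (fun z => ?_) a
    by_cases hO : z ∈ O
    · simp only [hO, if_true]
      calc ∑ n ∈ Finset.range N, iter k (n + 1) z b ≤ c * 1 := by
            rw [mul_one]; exact (iter_succ_le_potential k N z b).trans (hc z hO)
        _ ≤ c * (2 * escape k K f (N + 1) z) := by
            gcongr
            refine (hfO z hO).trans ?_
            gcongr
            exact le_escape hfK hf _ z
        _ = 2 * c * escape k K f (N + 1) z := by ring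
    · by_cases hK : z ∈ K
      · simp [hO, hK]
      · simpa [hO, hK, escape] using ih z

end Escape

/-- The weight of a closed path. -/
def loopWt {n : ℕ} [NeZero n] (γ : Fin n → V) : ℝ≥0∞ := ∏ i, k (γ i) (γ (i + 1))

lemma bridgeWt_eq_prod (n : ℕ) (a b : V) (δ : Fin n → V) :
    bridgeWt k n a b δ =
      ∏ i : Fin (n + 1), k (Fin.cons (α := fun _ => V) a δ i) (Fin.snoc (α := fun _ => V) δ b i) := by
  induction n generalizing a with
  | zero => simp [bridgeWt, Fin.snoc]
  | succ n ih =>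
    rw [bridgeWt, ih, Fin.prod_univ_succ (n := n + 1)]
    congr 1
    refine Finset.prod_congr rfl fun i _ => ?_
    congr 1
    · rw [Fin.cons_succ]
      refine Fin.cases ?_ (fun j => ?_) i <;> simp [Fin.tail]
    · refine Fin.lastCases ?_ (fun j => ?_) i
      · simp only [Fin.snoc_last, Fin.succ_last]
      · simp only [← Fin.castSucc_succ, Fin.snoc_castSucc, Fin.tail]

lemma loopWt_cons (n : ℕ) (a : V) (δ : Fin n → V) :
    loopWt k (Fin.cons a δ : Fin (n + 1) → V) = bridgeWt k n a a δ := by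
  rw [bridgeWt_eq_prod, loopWt]
  refine Finset.prod_congr rfl fun i _ => ?_
  congr 1
  refine Fin.lastCases ?_ (fun j => ?_) i
  · simp
  · simp

lemma loopWt_rotate {n : ℕ} [NeZero n] (i : Fin n) (γ : Fin n → V) :
    loopWt k (fun j => γ (j + i)) = loopWt k γ := by
  simp only [loopWt, add_right_comm _ (1 : Fin n) i]
  exact Fintype.prod_equiv (Equiv.addRight i) _ (fun j => k (γ j) (γ (j + 1))) fun _ => rfl

open Fin.NatCast Fin.CommRing in
lemma exists_rotate_reaches {K O : Set V} (hKO : Disjoint K O) {n : ℕ} {γ : Fin (n + 1) → V}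
    (hK : ∃ i, γ i ∈ K) (hO : ∃ i, γ i ∈ O) :
    ∃ i, γ i ∈ K ∧ Reaches K O n (Fin.tail fun j => γ (j + i)) := by
  obtain ⟨a, ha⟩ := hK
  obtain ⟨b, hb⟩ := hO
  have hex : ∃ l : ℕ, γ (b - (l : Fin (n + 1))) ∈ K := ⟨(b - a).val, by simpa using ha⟩
  have hspec := Nat.find_spec hex
  have hmin := fun l => Nat.find_min hex (m := l)
  have hle : Nat.find hex ≤ (b - a).val := Nat.find_min' hex (by simpa using ha)
  set l := Nat.find hex
  have hl0 : l ≠ 0 := by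
    intro h
    rw [h] at hspec
    exact Set.disjoint_left.1 hKO (by simpa using hspec) hb
  obtain ⟨m, hm⟩ := Nat.exists_eq_succ_of_ne_zero hl0
  have hmn : m < n := by have := (b - a).isLt; omega
  refine ⟨_, hspec, reaches_of_exists (j := ⟨m, hmn⟩) ?_ fun i hi => ?_⟩
  · have : (Fin.succ ⟨m, hmn⟩ : Fin (n + 1)) = (l : Fin (n + 1)) := by
      rw [hm, ← Fin.cast_val_eq_self (Fin.succ _)]; rfl
    simpa [Fin.tail, this] using hb
  · have hi' : i.val < m := hi
    have h1 := hmin (m - i.val) (by omega)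
    have h2 : (l : Fin (n + 1)) = (i.succ : Fin (n + 1)) + ((m - i.val : ℕ) : Fin (n + 1)) := by
      have : l = (i.val + 1) + (m - i.val) := by omega
      rw [this, Nat.cast_add]
      congr 1
      ext; simp
    have h3 : b - ((m - i.val : ℕ) : Fin (n + 1)) = i.succ + (b - (l : Fin (n + 1))) := by
      rw [h2]; abel
    simpa [Fin.tail, h3] using h1

/-- Rooting the loops at the start of a crossing from `K` to `O`. -/
lemma tsum_loopWt_le {K O : Set V} (hKO : Disjoint K O) (n : ℕ) :
    ∑' γ : Fin (n + 1) → V, {γ | (∃ i, γ i ∈ K) ∧ ∃ i, γ i ∈ O}.indicator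
        (fun γ => ((n + 1 : ℕ) : ℝ≥0∞)⁻¹ * loopWt k γ) γ ≤
      ∑' y, K.indicator (fun y => crossWt k K O n y y) y := by
  set F : (Fin (n + 1) → V) → ℝ≥0∞ := fun γ =>
    if γ 0 ∈ K ∧ Reaches K O n (Fin.tail γ) then loopWt k γ else 0 with hF
  have hrot : ∀ i : Fin (n + 1), ∑' γ : Fin (n + 1) → V, F (fun j => γ (j + i)) = ∑' γ, F γ :=
    fun i => ((Equiv.addRight i).symm.arrowCongr (Equiv.refl V)).tsum_eq F
  calc _ ≤ ∑' γ : Fin (n + 1) → V,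
        ((n + 1 : ℕ) : ℝ≥0∞)⁻¹ * ∑ i : Fin (n + 1), F (fun j => γ (j + i)) := by
        refine ENNReal.tsum_le_tsum fun γ => ?_
        refine Set.indicator_apply_le' (fun h => ?_) fun _ => zero_le
        obtain ⟨i, hi, hr⟩ := exists_rotate_reaches hKO h.1 h.2
        gcongr
        calc loopWt k γ = F (fun j => γ (j + i)) := by
              simp only [hF, zero_add, hi, hr, and_self, if_true, loopWt_rotate]
          _ ≤ _ := Finset.single_le_sum (f := fun i => F (fun j => γ (j + i)))
              (fun _ _ => zero_le) (Finset.mem_univ i)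
    _ = ∑' γ, F γ := by
        rw [ENNReal.tsum_mul_left, Summable.tsum_finsetSum fun _ _ => ENNReal.summable]
        simp only [hrot, Finset.sum_const, Finset.card_univ, Fintype.card_fin, nsmul_eq_mul]
        rw [← mul_assoc, ENNReal.inv_mul_cancel (by simp) (ENNReal.natCast_ne_top _), one_mul]
    _ ≤ _ := by
        rw [tsum_fin_succ]
        refine ENNReal.tsum_le_tsum fun y => ?_
        simp only [hF, Fin.cons_zero, Fin.tail_cons, loopWt_cons]
        by_cases hy : y ∈ K <;> simp [hy, crossWt]

end PathKernel

namespace WGraph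

variable (M : WGraph)

/-- The transition kernel of the random walk, as a nonnegative kernel. -/
def kern (x y : M.V) : ℝ≥0∞ := ENNReal.ofReal (M.p x y)

lemma lamTot_nonneg (x : M.V) : 0 ≤ M.lamTot x := finsum_nonneg fun y => M.lam_nonneg x y

lemma p_nonneg (x y : M.V) : 0 ≤ M.p x y := div_nonneg (M.lam_nonneg x y) (M.lamTot_nonneg x)

lemma pstep_nonneg (n : ℕ) (x y : M.V) : 0 ≤ M.pstep n x y := by
  induction n generalizing x with
  | zero => rw [pstep]; split_ifs <;> norm_num
  | succ n ih => exact finsum_nonneg fun z => mul_nonneg (M.p_nonneg x z) (ih z)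

lemma support_p_subset (x : M.V) (f : M.V → ℝ) :
    Function.support (fun z => M.p x z * f z) ⊆ (M.locFin x).toFinset := by
  intro z hz
  simp only [Set.Finite.coe_toFinset, Function.mem_support] at hz ⊢
  exact fun h => hz (by simp [p, h])

lemma ofReal_finsum_p_mul (x : M.V) {f : M.V → ℝ} (hf : ∀ z, 0 ≤ f z) :
    ENNReal.ofReal (∑ᶠ z, M.p x z * f z) = ∑' z, M.kern x z * ENNReal.ofReal (f z) := by
  rw [finsum_eq_sum_of_support_subset _ (M.support_p_subset x f),
    ENNReal.ofReal_sum_of_nonneg fun z _ => mul_nonneg (M.p_nonneg x z) (hf z),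
    tsum_eq_sum (s := (M.locFin x).toFinset)]
  · exact Finset.sum_congr rfl fun z _ => ENNReal.ofReal_mul (M.p_nonneg x z)
  · intro z hz
    have : M.lam x z = 0 := by simpa using hz
    simp [kern, p, this]

lemma tsum_kern {x : M.V} (hx : M.lamTot x ≠ 0) : ∑' z, M.kern x z = 1 := by
  have h := M.ofReal_finsum_p_mul x (f := fun _ => 1) fun _ => zero_le_one
  simp only [ENNReal.ofReal_one, mul_one] at h
  rw [← h]
  have : ∑ᶠ z, M.p x z = 1 := by
    simp only [p, div_eq_mul_inv]
    rw [← finsum_mul' _ _ (M.locFin x)]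
    exact mul_inv_cancel₀ hx
  simp [this]

lemma iter_kern (n : ℕ) (x y : M.V) :
    PathKernel.iter M.kern n x y = ENNReal.ofReal (M.pstep n x y) := by
  induction n generalizing x with
  | zero => rw [PathKernel.iter, pstep]; split_ifs <;> simp
  | succ n ih =>
    rw [PathKernel.iter, pstep, M.ofReal_finsum_p_mul x fun z => M.pstep_nonneg n z y]
    simp only [ih]

lemma lamTot_pos_of_green {x y : M.V} (h : 0 < M.green x y) : 0 < M.lamTot y :=
  (M.lamTot_nonneg y).lt_of_ne' fun h0 => by simp [green, h0] at h

lemma potential_kern {x y : M.V} (h : 0 < M.green x y) :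
    PathKernel.potential M.kern x y = ENNReal.ofReal (M.green x y * M.lamTot y) := by
  have hl := (M.lamTot_pos_of_green h).ne'
  have hs : Summable fun n => M.pstep n x y := by
    by_contra hns
    simp [green, tsum_eq_zero_of_not_summable hns] at h
  simp only [PathKernel.potential, iter_kern]
  rw [← ENNReal.ofReal_tsum_of_nonneg (fun n => M.pstep_nonneg n x y) hs, green,
    div_mul_cancel₀ _ hl]

section Capacity

variable {M} {K : Finset M.V}

lemma energy_nonneg (hg : ∀ x y, 0 ≤ M.green x y) {μ : M.V → ℝ} (hμ : ∀ x, 0 ≤ μ x) :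
    0 ≤ ∑ x ∈ K, ∑ y ∈ K, μ x * M.green x y * μ y :=
  Finset.sum_nonneg fun x _ => Finset.sum_nonneg fun y _ =>
    mul_nonneg (mul_nonneg (hμ x) (hg x y)) (hμ y)

lemma capFinset_nonneg (hg : ∀ x y, 0 ≤ M.green x y) : 0 ≤ M.capFinset K :=
  inv_nonneg.2 <| Real.sInf_nonneg <| by
    rintro _ ⟨μ, hμ, -, -, rfl⟩
    exact energy_nonneg hg hμ

lemma div_card_le_energy (hg : ∀ x y, 0 ≤ M.green x y) {c : ℝ} (hc0 : 0 ≤ c)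
    (hc : ∀ x, c ≤ M.green x x) {μ : M.V → ℝ} (hμ : ∀ x, 0 ≤ μ x) (h1 : ∑ x ∈ K, μ x = 1) :
    c / K.card ≤ ∑ x ∈ K, ∑ y ∈ K, μ x * M.green x y * μ y := by
  have hcard : (0 : ℝ) < K.card := by
    rcases K.eq_empty_or_nonempty with rfl | h
    · simp at h1
    · exact_mod_cast h.card_pos
  have hcs : (1 : ℝ) ≤ K.card * ∑ x ∈ K, μ x ^ 2 := by
    simpa [h1] using sq_sum_le_card_mul_sum_sq (s := K) (f := μ)
  calc c / K.card ≤ c * ∑ x ∈ K, μ x ^ 2 := by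
        rw [div_le_iff₀ hcard]; nlinarith
    _ = ∑ x ∈ K, μ x * c * μ x := by
        rw [Finset.mul_sum]; exact Finset.sum_congr rfl fun _ _ => by ring
    _ ≤ _ := by
        refine Finset.sum_le_sum fun x hx => ?_
        calc μ x * c * μ x ≤ μ x * M.green x x * μ x := by
              gcongr
              · exact hμ x
              · exact hμ x
              · exact hc x
          _ ≤ _ := Finset.single_le_sum (f := fun y => μ x * M.green x y * μ y)
              (fun y _ => mul_nonneg (mul_nonneg (hμ x) (hg x y)) (hμ y)) hx

/-- A measure whose potential is at most one on `K` has mass at most `cap(K)`. -/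
lemma sum_le_capFinset (hg : ∀ x y, 0 ≤ M.green x y) {c : ℝ} (hc0 : 0 < c)
    (hc : ∀ x, c ≤ M.green x x) {e : M.V → ℝ} (he : ∀ x, 0 ≤ e x)
    (hGe : ∀ x ∈ K, ∑ y ∈ K, M.green x y * e y ≤ 1) :
    ∑ x ∈ K, e x ≤ M.capFinset K := by
  set s := ∑ x ∈ K, e x with hs
  rcases (Finset.sum_nonneg fun x _ => he x : 0 ≤ s).eq_or_lt with h0 | hpos
  · rw [hs, ← h0]; exact capFinset_nonneg hg
  set μ : M.V → ℝ := fun x => if x ∈ K then e x / s else 0 with hμdef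
  have hμ : ∀ x, 0 ≤ μ x := fun x => by
    simp only [hμdef]; split_ifs
    · exact div_nonneg (he x) hpos.le
    · exact le_rfl
  have hμ1 : ∑ x ∈ K, μ x = 1 := by
    rw [Finset.sum_congr rfl fun x hx => if_pos hx, ← Finset.sum_div, ← hs, div_self hpos.ne']
  have hE : ∑ x ∈ K, ∑ y ∈ K, μ x * M.green x y * μ y ≤ s⁻¹ := by
    calc ∑ x ∈ K, ∑ y ∈ K, μ x * M.green x y * μ y
        = ∑ x ∈ K, e x / s * (s⁻¹ * ∑ y ∈ K, M.green x y * e y) := by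
          refine Finset.sum_congr rfl fun x hx => ?_
          rw [Finset.mul_sum, Finset.mul_sum]
          refine Finset.sum_congr rfl fun y hy => ?_
          simp only [hμdef, hx, hy, if_true]
          ring
      _ ≤ ∑ x ∈ K, e x / s * (s⁻¹ * 1) := by
          refine Finset.sum_le_sum fun x hx => ?_
          have := hGe x hx
          have := he x
          gcongr
      _ = s⁻¹ := by
          rw [← Finset.sum_mul, ← Finset.sum_div, ← hs, div_self hpos.ne', mul_one, one_mul]
  have hcard : (0 : ℝ) < K.card := by
    rcases K.eq_empty_or_nonempty with h | h
    · simp [h] at hμ1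
    · exact_mod_cast h.card_pos
  rw [capFinset, le_inv_comm₀ hpos]
  · refine (csInf_le ⟨0, ?_⟩ ?_).trans hE
    · rintro _ ⟨μ', hμ', -, -, rfl⟩
      exact energy_nonneg hg hμ'
    · exact ⟨μ, hμ, fun x hx => if_neg hx, hμ1, rfl⟩
  · refine (div_pos hc0 hcard).trans_le (le_csInf ⟨_, μ, hμ, fun x hx => if_neg hx, hμ1, rfl⟩ ?_)
    rintro _ ⟨μ', hμ', -, h1', rfl⟩
    exact div_card_le_energy hg hc0.le hc hμ' h1'

lemma capFinset_le_cap (K : Finset M.V) : M.capFinset K ≤ M.cap K := by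
  have : Finite {K' : Finset M.V // (K' : Set M.V) ⊆ K} :=
    Set.Finite.to_subtype <| K.powerset.finite_toSet.subset fun K' h => by
      exact Finset.mem_coe.2 (Finset.mem_powerset.2 (Finset.coe_subset.1 h))
  exact le_ciSup (f := fun K' : {K' : Finset M.V // (K' : Set M.V) ⊆ K} => M.capFinset K'.1)
    (Set.finite_range _).bddAbove ⟨K, subset_rfl⟩

end Capacity

variable {M}

lemma finite_ball (hV : M.VolGrowth) (hl : ∀ x, 0 < M.lamTot x) (x : M.V) {r : ℝ} (hr : 1 ≤ r) :
    (M.ball x r).Finite := by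
  obtain ⟨c, hc, _, _, h⟩ := hV
  by_contra hinf
  have h0 : ∑ᶠ y ∈ M.ball x r, M.lamTot y = 0 := by
    refine finsum_mem_eq_zero_of_infinite ?_
    rwa [Set.inter_eq_left.2 fun y _ => Function.mem_support.2 (hl y).ne']
  have := (h x r hr).1
  rw [h0] at this
  exact this.not_gt (by positivity)

lemma dloopWt_eq (m : ℕ) (γ : Fin (m + 2) → M.V) :
    M.dloopWt ⟨m, γ⟩ = ((m + 1 + 1 : ℕ) : ℝ≥0∞)⁻¹ * PathKernel.loopWt M.kern γ := by
  rw [dloopWt, ENNReal.ofReal_mul (by positivity),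
    ENNReal.ofReal_prod_of_nonneg fun i _ => M.p_nonneg _ _]
  congr 1
  rw [one_div, ENNReal.ofReal_inv_of_pos (by positivity), ← ENNReal.ofReal_natCast]
  congr 2
  push_cast
  ring

/-- The loop measure of loops crossing between `K` and `O` is bounded through a subharmonic
function vanishing on `K` and at least `1/2` on `O`. -/
lemma loopMeas_crossing_le {K : Finset M.V} {O : Set M.V} (hKO : Disjoint (K : Set M.V) O)
    (hg : ∀ x y, 0 < M.green x y) {c : ℝ} (hc0 : 0 < c) (hc : ∀ x, c ≤ M.green x x)
    {f : M.V → ℝ≥0∞} (hfK : ∀ y ∈ K, f y = 0) (hf : f ≤ PathKernel.avg M.kern f)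
    (hf1 : ∀ y, f y ≤ 1) (hfO : ∀ y ∈ O, 1 ≤ 2 * f y) {b : ℝ} (hb0 : 0 ≤ b)
    (hb : ∀ z ∈ O, ∀ y ∈ K, M.green z y ≤ b) :
    M.loopMeas {γ | (M.dloopRange γ ∩ K).Nonempty ∧ (M.dloopRange γ ∩ O).Nonempty} ≤
      ENNReal.ofReal (2 * b * M.capFinset K) := by
  have hl : ∀ y, 0 < M.lamTot y := fun y => M.lamTot_pos_of_green (hg y y)
  have hk : ∀ a, ∑' z, M.kern a z = 1 := fun a => M.tsum_kern (hl a).ne'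
  have hfK' : ∀ y ∈ (K : Set M.V), f y = 0 := fun y hy => hfK y hy
  rw [loopMeas, tsum_subtype, ENNReal.tsum_sigma']
  refine ENNReal.tsum_le_of_sum_range_le fun N => ?_
  set h := PathKernel.escape M.kern (K : Set M.V) f (N + 1) with hh
  have hh1 : ∀ y, h y ≤ 1 := PathKernel.escape_le_one hk hf1 (N + 1)
  set u := PathKernel.avg M.kern h with hu
  have hu1 : ∀ y, u y ≤ 1 := PathKernel.avg_le_one _ hk hh1
  have hut : ∀ y, u y ≠ ⊤ := fun y => ((hu1 y).trans_lt ENNReal.one_lt_top).ne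
  set e : M.V → ℝ := fun y => M.lamTot y * (u y).toReal with he_def
  have he : ∀ y, 0 ≤ e y := fun y => mul_nonneg (hl y).le ENNReal.toReal_nonneg
  have hcap : ∑ y ∈ K, e y ≤ M.capFinset K := by
    refine sum_le_capFinset (fun x y => (hg x y).le) hc0 hc he fun x _ => ?_
    have hpot := PathKernel.sum_potential_mul_le_one hk hh1
      (PathKernel.escape_add_le hfK' hf (N + 1)) x
    rw [← ENNReal.ofReal_le_one, ENNReal.ofReal_sum_of_nonneg fun y _ =>
      mul_nonneg (hg x y).le (he y)]
    refine le_trans ?_ ((ENNReal.sum_le_tsum K).trans hpot)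
    refine Finset.sum_le_sum fun y hy => ?_
    rw [M.potential_kern (hg x y), Set.indicator_of_mem (Finset.mem_coe.2 hy), ← mul_assoc,
      ENNReal.ofReal_mul (mul_nonneg (hg x y).le (hl y).le), ENNReal.ofReal_toReal (hut y)]
  calc _ ≤ ∑ m ∈ Finset.range N, ∑ y ∈ K, PathKernel.crossWt M.kern K O (m + 1) y y := by
        refine Finset.sum_le_sum fun m _ => ?_
        have := PathKernel.tsum_loopWt_le M.kern hKO (m + 1)
        rw [← tsum_subtype (K : Set M.V), Finset.tsum_subtype' K fun y =>
          PathKernel.crossWt M.kern (K : Set M.V) O (m + 1) y y] at this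
        refine le_trans (ENNReal.tsum_le_tsum fun γ => ?_) this
        refine Set.indicator_apply_le' (fun h => ?_) fun _ => zero_le
        rw [Set.indicator_of_mem, dloopWt_eq]
        obtain ⟨⟨_, ⟨i, rfl⟩, hi⟩, _, ⟨j, rfl⟩, hj⟩ := h
        exact ⟨⟨i, hi⟩, j, hj⟩
    _ = ∑ y ∈ K, ∑ m ∈ Finset.range N, PathKernel.crossWt M.kern K O (m + 1) y y :=
        Finset.sum_comm
    _ ≤ ∑ y ∈ K, ENNReal.ofReal (2 * b * e y) := by
        refine Finset.sum_le_sum fun y hy => ?_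
        have h1 := PathKernel.sum_crossWt_le hfK' hf hfO
          (b := y) (c := ENNReal.ofReal (b * M.lamTot y)) (fun z hz => by
            rw [M.potential_kern (hg z y)]
            exact ENNReal.ofReal_le_ofReal
              (mul_le_mul_of_nonneg_right (hb z hz y hy) (hl y).le)) (N + 1) y
        rw [Finset.sum_range_succ', PathKernel.crossWt_zero, add_zero] at h1
        refine h1.trans (le_of_eq ?_)
        rw [show 2 * b * e y = 2 * (b * M.lamTot y) * (u y).toReal by simp only [he_def]; ring,
          ENNReal.ofReal_mul (mul_nonneg zero_le_two (mul_nonneg hb0 (hl y).le)),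
          ENNReal.ofReal_mul zero_le_two, ENNReal.ofReal_toReal (hut y), ENNReal.ofReal_ofNat]
    _ = ENNReal.ofReal (2 * b * ∑ y ∈ K, e y) := by
        rw [Finset.mul_sum, ENNReal.ofReal_sum_of_nonneg fun y _ =>
          mul_nonneg (mul_nonneg zero_le_two hb0) (he y)]
    _ ≤ _ := ENNReal.ofReal_le_ofReal (by gcongr)

/-- One minus a multiple of the Green's function, truncated at zero, is subharmonic. -/
lemma one_sub_potential_le_avg (hl : ∀ y, M.lamTot y ≠ 0) (x : M.V) (κ : ℝ≥0∞) :
    (fun y => 1 - κ * PathKernel.potential M.kern y x) ≤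
      PathKernel.avg M.kern (fun y => 1 - κ * PathKernel.potential M.kern y x) := by
  intro y
  rw [tsub_le_iff_right]
  calc (1 : ℝ≥0∞) = PathKernel.avg M.kern (fun _ => 1) y := by
        simp only [PathKernel.avg, mul_one]; exact (M.tsum_kern (hl y)).symm
    _ ≤ PathKernel.avg M.kern (fun y => (1 - κ * PathKernel.potential M.kern y x) +
          κ * PathKernel.potential M.kern y x) y :=
        PathKernel.avg_mono _ (fun z => le_tsub_add) y
    _ ≤ _ := by
        rw [PathKernel.avg_add, PathKernel.avg_const_mul]
        gcongr
        exact PathKernel.avg_potential_le _ _ _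

end WGraph

/-- **Lemma 3.1, upper bound (loop-measure crossing estimate).** -/
theorem loop_measure_crossing_upper (M : WGraph) (hS : M.Standing)
    (hν0 : 0 < M.ν) (hνα : M.ν ≤ M.α / 2) :
    ∃ C > (0:ℝ), ∀ (ζ R : ℝ) (x : M.V) (K : Set M.V),
      C ≤ ζ → 1 ≤ R → K ⊆ M.ball x R →
      M.loopMeas {γ | (M.dloopRange γ ∩ K).Nonempty ∧
          (M.dloopRange γ \ M.ball x (ζ * R)).Nonempty} ≤
        ENNReal.ofReal (C * M.cap K * (ζ * R) ^ (-M.ν)) := by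
  obtain ⟨-, hV, c, hc, C, hC, hdiag, hoff⟩ := hS
  have hg : ∀ x y, 0 < M.green x y := fun x y => by
    rcases eq_or_ne x y with rfl | hxy
    · exact hc.trans_le (hdiag x).1
    · exact (mul_pos hc (Real.rpow_pos_of_pos (M.d_pos x y hxy) _)).trans_le (hoff x y hxy).1
  have hl : ∀ y, 0 < M.lamTot y := fun y => M.lamTot_pos_of_green (hg y y)
  set Z : ℝ := (2 * C / c) ^ M.ν⁻¹ with hZ
  have hZ0 : 0 < Z := by positivity
  refine ⟨2 + Z + 2 * (C * 2 ^ M.ν), by positivity, fun ζ R x K hζ hR hK => ?_⟩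
  have hp2 : (0 : ℝ) < C * 2 ^ M.ν := by positivity
  have hζ2 : 2 ≤ ζ := by linarith
  have hζZ : Z ≤ ζ := by linarith
  have hζR : 0 < ζ * R := by positivity
  obtain ⟨F, rfl⟩ : ∃ F : Finset M.V, K = F :=
    ⟨((WGraph.finite_ball hV hl x hR).subset hK).toFinset, by simp⟩
  have hfar : ∀ z ∈ (M.ball x (ζ * R))ᶜ, ∀ y ∈ M.ball x R, ζ * R / 2 ≤ M.d z y := by
    intro z hz y hy
    have h1 : ζ * R < M.d x z := not_le.1 hz
    have h2 : M.d x y ≤ R := hy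
    have h3 := M.d_triangle x y z
    rw [M.d_symm y z] at h3
    nlinarith
  have hgfar : ∀ z y r, 0 < r → r ≤ M.d z y → M.green z y ≤ C * r ^ (-M.ν) := by
    intro z y r hr hrd
    have hne : z ≠ y := fun h => by rw [h, M.d_self] at hrd; linarith
    refine (hoff z y hne).2.trans ?_
    exact mul_le_mul_of_nonneg_left
      (Real.rpow_le_rpow_of_nonpos hr hrd (by linarith)) hC.le
  have hgnear : ∀ y ∈ M.ball x R, c * R ^ (-M.ν) ≤ M.green y x := by
    intro y hy
    rcases eq_or_ne y x with rfl | hne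
    · refine le_trans ?_ (hdiag y).1
      exact mul_le_of_le_one_right hc.le (Real.rpow_le_one_of_one_le_of_nonpos hR (by linarith))
    · refine le_trans ?_ (hoff y x hne).1
      refine mul_le_mul_of_nonneg_left
        (Real.rpow_le_rpow_of_nonpos (M.d_pos y x hne) ?_ (by linarith)) hc.le
      rw [M.d_symm]; exact hy
  have hR0 : (0 : ℝ) < c * R ^ (-M.ν) := by positivity
  set κ : ℝ≥0∞ := ENNReal.ofReal (M.lamTot x * (c * R ^ (-M.ν)))⁻¹ with hκ
  have hs : ∀ y, κ * PathKernel.potential M.kern y x =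
      ENNReal.ofReal (M.green y x / (c * R ^ (-M.ν))) := fun y => by
    rw [M.potential_kern (hg y x), hκ, ← ENNReal.ofReal_mul (by have := hl x; positivity)]
    congr 1
    have := (hl x).ne'
    field_simp
  have hmain := WGraph.loopMeas_crossing_le (K := F) (O := (M.ball x (ζ * R))ᶜ)
    (f := fun y => 1 - κ * PathKernel.potential M.kern y x) (b := C * (ζ * R / 2) ^ (-M.ν))
    (Set.disjoint_compl_right_iff_subset.2 fun y hy =>
      (show M.d x y ≤ ζ * R from le_trans (hK hy) (by nlinarith)))
    hg hc (fun y => (hdiag y).1)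
    (fun y hy => by
      rw [hs, tsub_eq_zero_iff_le, ENNReal.one_le_ofReal, one_le_div hR0]
      exact hgnear y (hK hy))
    (WGraph.one_sub_potential_le_avg (fun y => (hl y).ne') x κ) (fun y => tsub_le_self)
    (fun y hy => by
      have hle : M.green y x / (c * R ^ (-M.ν)) ≤ 1 / 2 := by
        have h1 : M.green y x ≤ C * (ζ * R) ^ (-M.ν) := by
          refine hgfar y x _ hζR ?_
          rw [M.d_symm]
          exact (not_le.1 (show ¬ M.d x y ≤ ζ * R from hy)).le
        have h2 : ζ ^ (-M.ν) ≤ c / (2 * C) := by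
          calc ζ ^ (-M.ν) ≤ Z ^ (-M.ν) := Real.rpow_le_rpow_of_nonpos hZ0 hζZ (by linarith)
            _ = c / (2 * C) := by
              rw [hZ, ← Real.rpow_mul (by positivity), mul_neg, inv_mul_cancel₀ hν0.ne',
                Real.rpow_neg_one, inv_div]
        rw [div_le_iff₀ hR0]
        calc M.green y x ≤ C * (ζ * R) ^ (-M.ν) := h1
          _ = C * (ζ ^ (-M.ν) * R ^ (-M.ν)) := by rw [Real.mul_rpow (by linarith) (by linarith)]
          _ ≤ C * (c / (2 * C) * R ^ (-M.ν)) := by gcongr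
          _ = 1 / 2 * (c * R ^ (-M.ν)) := by field_simp
      rw [hs, ← ENNReal.ofReal_one, ← ENNReal.ofReal_sub _ (by have := hg y x; positivity),
        ← ENNReal.ofReal_ofNat, ← ENNReal.ofReal_mul zero_le_two]
      exact ENNReal.ofReal_le_ofReal (by linarith))
    (by positivity)
    (fun z hz y hy => hgfar z y _ (by positivity) (hfar z hz y (hK hy)))
  refine hmain.trans (ENNReal.ofReal_le_ofReal ?_)
  have hcap0 : 0 ≤ M.capFinset F := WGraph.capFinset_nonneg fun x y => (hg x y).le
  have hcap := WGraph.capFinset_le_cap F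
  have hpow : (0 : ℝ) < (ζ * R) ^ (-M.ν) := by positivity
  have hhalf : (ζ * R / 2) ^ (-M.ν) = 2 ^ M.ν * (ζ * R) ^ (-M.ν) := by
    rw [Real.div_rpow hζR.le zero_le_two, Real.rpow_neg zero_le_two, div_inv_eq_mul, mul_comm]
  calc 2 * (C * (ζ * R / 2) ^ (-M.ν)) * M.capFinset F
      = 2 * (C * 2 ^ M.ν) * M.capFinset F * (ζ * R) ^ (-M.ν) := by rw [hhalf]; ring
    _ ≤ (2 + Z + 2 * (C * 2 ^ M.ν)) * M.cap F * (ζ * R) ^ (-M.ν) := by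
        gcongr
        linarith
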